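/- Let G be a strongly connected digraph on n vertices with no self-loops, with weights a_{ij} > 0 and weighted Laplacian L. If x = (x_1,…,x_n) ∈ (ℝ²)ⁿ and v ∈ ℝ² satisfy (L ⊗ I₂)x = 𝟙 ⊗ v (that is, every block component of (L ⊗ I₂)x equals v), then v = 0 and x_1 = x_2 = ⋯ = x_n. -/

import Mathlib

open scoped BigOperators Kronecker

/-- The weighted Laplacian `L = D - A` of a digraph with edge relation `Adj` and
weights `a`. -/
noncomputable def lap {n : ℕ} (Adj : Fin n → Fin n → Bool) (a : Fin n → Fin n → ℝ) :
    Matrix (Fin n) (Fin n) ℝ :=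
  Matrix.diagonal (fun i => ∑ j, if Adj i j = true then a i j else 0) -
    Matrix.of fun i j => if Adj i j = true then a i j else 0

theorem lap_mulVec_apply {n : ℕ} (Adj : Fin n → Fin n → Bool) (a : Fin n → Fin n → ℝ)
    (y : Fin n → ℝ) (i : Fin n) :
    (lap Adj a).mulVec y i = ∑ j, (if Adj i j = true then a i j else 0) * (y i - y j) := by
  simp only [lap, Matrix.sub_mulVec, Pi.sub_apply, Matrix.mulVec_diagonal, mul_sub,
    Finset.sum_sub_distrib, Finset.sum_mul]
  rfl

theorem lap_summand_nonneg {n : ℕ} {Adj : Fin n → Fin n → Bool} {a : Fin n → Fin n → ℝ}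
    (ha : ∀ i j, Adj i j = true → 0 < a i j) {y : Fin n → ℝ} {i : Fin n}
    (hi : ∀ j, y j ≤ y i) (j : Fin n) :
    0 ≤ (if Adj i j = true then a i j else 0) * (y i - y j) := by
  refine mul_nonneg ?_ (sub_nonneg.2 (hi j))
  split_ifs with hij
  · exact (ha i j hij).le
  · exact le_rfl

/-- If the Laplacian maps a vector to a constant vector, that constant is nonnegative:
evaluate at a vertex where the vector is maximal. -/
theorem nonneg_of_lap_mulVec_eq_const {n : ℕ} (hn : 0 < n) {Adj : Fin n → Fin n → Bool}
    {a : Fin n → Fin n → ℝ} (ha : ∀ i j, Adj i j = true → 0 < a i j) {y : Fin n → ℝ} {c : ℝ}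
    (h : ∀ i, (lap Adj a).mulVec y i = c) : 0 ≤ c := by
  have : Nonempty (Fin n) := ⟨⟨0, hn⟩⟩
  obtain ⟨i, hi⟩ := Finite.exists_max y
  rw [← h i, lap_mulVec_apply]
  exact Finset.sum_nonneg fun j _ => lap_summand_nonneg ha hi j

theorem eq_zero_of_lap_mulVec_eq_const {n : ℕ} (hn : 0 < n) {Adj : Fin n → Fin n → Bool}
    {a : Fin n → Fin n → ℝ} (ha : ∀ i j, Adj i j = true → 0 < a i j) {y : Fin n → ℝ} {c : ℝ}
    (h : ∀ i, (lap Adj a).mulVec y i = c) : c = 0 := by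
  refine le_antisymm ?_ (nonneg_of_lap_mulVec_eq_const hn ha h)
  have hneg : 0 ≤ -c := nonneg_of_lap_mulVec_eq_const hn ha (y := -y) fun i => by
    rw [Matrix.mulVec_neg, Pi.neg_apply, h i]
  linarith

/-- The kernel of the Laplacian of a strongly connected digraph consists of constant vectors. -/
theorem eq_of_lap_mulVec_eq_zero {n : ℕ} {Adj : Fin n → Fin n → Bool}
    (hsc : ∀ i j : Fin n, Relation.ReflTransGen (fun p q => Adj p q = true) i j)
    {a : Fin n → Fin n → ℝ} (ha : ∀ i j, Adj i j = true → 0 < a i j) {y : Fin n → ℝ}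
    (h : ∀ i, (lap Adj a).mulVec y i = 0) (i j : Fin n) : y i = y j := by
  have : Nonempty (Fin n) := ⟨i⟩
  obtain ⟨m, hm⟩ := Finite.exists_max y
  have hconst : ∀ k, y k = y m := fun k => by
    induction hsc m k with
    | refl => rfl
    | @tail p q _ hpq ih =>
      have hp : ∀ k, y k ≤ y p := fun k => ih ▸ hm k
      have hsum := h p
      rw [lap_mulVec_apply,
        Finset.sum_eq_zero_iff_of_nonneg fun k _ => lap_summand_nonneg ha hp k] at hsum
      have hq := hsum q (Finset.mem_univ q)
      rw [if_pos hpq, mul_eq_zero, or_iff_right (ha p q hpq).ne'] at hq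
      linarith
  rw [hconst i, hconst j]

theorem kronecker_one_mulVec_apply {n : ℕ} (M : Matrix (Fin n) (Fin n) ℝ)
    (x : Fin n → Fin 2 → ℝ) (i : Fin n) (k : Fin 2) :
    (M ⊗ₖ (1 : Matrix (Fin 2) (Fin 2) ℝ)).mulVec (fun p => x p.1 p.2) (i, k) =
      M.mulVec (fun j => x j k) i := by
  simp [Matrix.mulVec, dotProduct, Fintype.sum_prod_type, Matrix.kroneckerMap_apply,
    Matrix.one_apply]

/-- for a strongly connected digraph (no self-loops, positive weights),
if `(L ⊗ I₂)x = 𝟙 ⊗ v` for some `x ∈ (ℝ²)ⁿ`, `v ∈ ℝ²`, then `v = 0` and all the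
`xᵢ` coincide. -/
theorem kronecker_ones_eq_implies_consensus {n : ℕ} (hn : 0 < n)
    (Adj : Fin n → Fin n → Bool) (hloop : ∀ i, Adj i i = false)
    (hsc : ∀ i j : Fin n, Relation.ReflTransGen (fun p q => Adj p q = true) i j)
    (a : Fin n → Fin n → ℝ) (ha : ∀ i j, Adj i j = true → 0 < a i j)
    (x : Fin n → Fin 2 → ℝ) (v : Fin 2 → ℝ)
    (h : (lap Adj a ⊗ₖ (1 : Matrix (Fin 2) (Fin 2) ℝ)).mulVec (fun p => x p.1 p.2) =
      fun p => v p.2) :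
    v = 0 ∧ ∀ i j, x i = x j := by
  have hk : ∀ k i, (lap Adj a).mulVec (fun j => x j k) i = v k := fun k i => by
    rw [← kronecker_one_mulVec_apply, h]
  have hv : ∀ k, v k = 0 := fun k => eq_zero_of_lap_mulVec_eq_const hn ha (hk k)
  refine ⟨funext hv, fun i j => funext fun k => ?_⟩
  exact eq_of_lap_mulVec_eq_zero hsc ha (fun i => (hk k i).trans (hv k)) i j
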